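/- arXiv:2003.10231 — 2 statements merged into one kernel-verified Lean document; each statement's English description precedes it below -/
import Mathlib

section
/- There exists a nonregular positroidal subdivision of the hypersimplex Δ_{3,12}: there is a finite collection 𝒞 of families of 3-element subsets of [12] such that (i) each B ∈ 𝒞 is the basis family of a positroid on [12] and the polytope conv{ e_I : I ∈ B } ⊂ ℝ¹² has affine dimension 11; (ii) the union over B ∈ 𝒞 of conv{ e_I : I ∈ B } equals Δ_{3,12} = conv{ e_I : I a 3-subset of [12] }; (iii) for all B, B' ∈ 𝒞, conv{ e_I : I ∈ B } ∩ conv{ e_I : I ∈ B' } = conv{ e_I : I ∈ B ∩ B' } and this intersection is an exposed face of each of the two polytopes; and (iv) there is no function P from the 3-subsets of [12] to ℝ such that 𝒞 equals the collection of those sets Face_P(λ), λ ∈ ℝ¹², whose polytope conv{ e_I : I ∈ Face_P(λ) } has affine dimension 11. -/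
/-- The maximal minor `p_I(A)` of a `k × n` matrix `A` on the columns indexed by the
`k`-element subset `I`, taken in increasing order (junk value `0` if `I.card ≠ k`). -/
noncomputable def pMinor {R : Type*} [CommRing R] {k n : ℕ}
    (A : Matrix (Fin k) (Fin n) R) (I : Finset (Fin n)) : R :=
  if hI : I.card = k then
    Matrix.det (Matrix.of fun r c => A r ((I.orderIsoOfFin hI c : Fin n)))
  else 0

/-- `ℬ` is the basis family of a positroid on `[n]`. -/
def IsPositroidFamily (n k : ℕ) (ℬ : Set (Finset (Fin n))) : Prop :=
  ∃ A : Matrix (Fin k) (Fin n) ℝ,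
    (∀ I : Finset (Fin n), I.card = k → 0 ≤ pMinor A I) ∧
    (∀ I : Finset (Fin n), I ∈ ℬ ↔ I.card = k ∧ pMinor A I ≠ 0)

/-- The polytope spanned by the indicator vectors of a family of subsets of `[n]`. -/
noncomputable def familyPolytope (n : ℕ) (ℬ : Set (Finset (Fin n))) : Set (Fin n → ℝ) :=
  convexHull ℝ {x : Fin n → ℝ | ∃ I ∈ ℬ, x = fun i => if i ∈ I then (1 : ℝ) else 0}

/-- The vertex set of the face of the regular subdivision `D_P` of the hypersimplex
selected by `λ`: the `k`-subsets `I` maximizing `∑_{i ∈ I} λ_i - P(I)`. -/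
def FaceOf (n k : ℕ) (P : Finset (Fin n) → ℝ) (lam : Fin n → ℝ) : Set (Finset (Fin n)) :=
  {I | I.card = k ∧ ∀ J : Finset (Fin n), J.card = k →
    (∑ i ∈ J, lam i) - P J ≤ (∑ i ∈ I, lam i) - P I}

namespace Alcoved

open MeasureTheory

theorem intervalIntegral_floor_add (s : ℝ) : ∫ t in (0 : ℝ)..1, (⌊s + t⌋ : ℝ) = s := by
  have hper : Function.Periodic (Int.fract : ℝ → ℝ) 1 := Int.fract_periodic ℝ
  have hfract : ∫ t in (0 : ℝ)..1, Int.fract (s + t) = 1 / 2 := by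
    rw [intervalIntegral.integral_comp_add_left (fun t => Int.fract t) s, add_zero,
      hper.intervalIntegral_add_eq s 0, zero_add]
    have : ∫ t in (0 : ℝ)..1, Int.fract t = ∫ t in (0 : ℝ)..1, t :=
      intervalIntegral.integral_congr_Ioo_of_le zero_le_one
        fun t ht => Int.fract_eq_self.2 ⟨ht.1.le, ht.2⟩
    rw [this]
    simp
  have hfloor : IntervalIntegrable (fun t : ℝ => (⌊s + t⌋ : ℝ)) volume 0 1 :=
    Monotone.intervalIntegrable fun a b hab => by
      exact_mod_cast Int.floor_mono (by linarith : s + a ≤ s + b)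
  have hlin : IntervalIntegrable (fun t : ℝ => s + t) volume 0 1 :=
    (by fun_prop : Continuous fun t : ℝ => s + t).intervalIntegrable 0 1
  have hsub := intervalIntegral.integral_sub hlin hfloor
  have hself : ∀ t : ℝ, s + t - ⌊s + t⌋ = Int.fract (s + t) := fun t => Int.self_sub_floor _
  simp only [hself, hfract] at hsub
  rw [intervalIntegral.integral_add (by simp) (by simp)] at hsub
  simp at hsub
  linarith

/-- The sum of the coordinates of `x` at the first `p` positions. -/
noncomputable def prefixSum {n : ℕ} (x : Fin n → ℝ) (p : ℕ) : ℝ :=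
  ∑ i with i.val < p, x i

/-- The number of elements of `I` among the first `p` positions. -/
def prefixCard {n : ℕ} (I : Finset (Fin n)) (p : ℕ) : ℕ :=
  (I.filter fun i => i.val < p).card

/-- The indicator vector of `I`. -/
def indicatorVec {n : ℕ} (I : Finset (Fin n)) : Fin n → ℝ :=
  fun i => if i ∈ I then 1 else 0

theorem prefixSum_indicatorVec {n : ℕ} (I : Finset (Fin n)) (p : ℕ) :
    prefixSum (indicatorVec I) p = prefixCard I p := by
  simp only [prefixSum, indicatorVec, prefixCard, Finset.sum_boole]
  congr 2
  ext i
  simp [and_comm]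

theorem sum_indicatorVec {n : ℕ} (I : Finset (Fin n)) : ∑ i, indicatorVec I i = I.card := by
  simp [indicatorVec]

theorem prefixSum_zero {n : ℕ} (x : Fin n → ℝ) : prefixSum x 0 = 0 := by
  simp [prefixSum]

theorem prefixSum_succ {n : ℕ} (x : Fin n → ℝ) (i : Fin n) :
    prefixSum x (i + 1) = prefixSum x i + x i := by
  have : (Finset.univ.filter fun j : Fin n => j.val < i.val + 1) =
      insert i (Finset.univ.filter fun j : Fin n => j.val < i.val) := by
    ext j
    simp only [Finset.mem_filter, Finset.mem_univ, true_and, Finset.mem_insert, Fin.ext_iff]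
    omega
  rw [prefixSum, prefixSum, this, Finset.sum_insert (by simp), add_comm]

theorem prefixSum_of_le {n : ℕ} (x : Fin n → ℝ) {p : ℕ} (hp : n ≤ p) :
    prefixSum x p = ∑ i, x i := by
  rw [prefixSum, Finset.filter_true_of_mem fun i _ => i.isLt.trans_le hp]

theorem prefixSum_eq_of_succ {n : ℕ} {x : Fin n → ℝ} {g : ℕ → ℝ} (h0 : g 0 = 0)
    (hg : ∀ i : Fin n, x i = g (i + 1) - g i) {p : ℕ} (hp : p ≤ n) : prefixSum x p = g p := by
  induction p with
  | zero => rw [prefixSum_zero, h0]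
  | succ p ih =>
    rw [prefixSum_succ x ⟨p, hp⟩, ih (by omega), hg]
    simp

/-- The formal inequality `s p + d ≤ s q + c` between prefix sums. -/
structure Ineq where
  p : ℕ
  q : ℕ
  d : ℕ
  c : ℕ

namespace Ineq

/-- The opposite inequality. -/
def reverse (a : Ineq) : Ineq := ⟨a.q, a.p, a.c, a.d⟩

/-- The inequality holds at the set `I`. -/
def HoldsAt {n : ℕ} (a : Ineq) (I : Finset (Fin n)) : Prop :=
  prefixCard I a.p + a.d ≤ prefixCard I a.q + a.c

instance {n : ℕ} (a : Ineq) (I : Finset (Fin n)) : Decidable (a.HoldsAt I) :=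
  inferInstanceAs (Decidable (_ ≤ _))

/-- The inequality holds at the vector `x`. -/
def Holds {n : ℕ} (a : Ineq) (x : Fin n → ℝ) : Prop :=
  prefixSum x a.p + a.d ≤ prefixSum x a.q + a.c

/-- The linear functional whose bound is expressed by the inequality. -/
noncomputable def functional (n : ℕ) (a : Ineq) : StrongDual ℝ (Fin n → ℝ) :=
  ∑ i with i.val < a.p, ContinuousLinearMap.proj i - ∑ i with i.val < a.q, ContinuousLinearMap.proj i

theorem functional_apply {n : ℕ} (a : Ineq) (x : Fin n → ℝ) :
    a.functional n x = prefixSum x a.p - prefixSum x a.q := by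
  simp [functional, prefixSum]

theorem holds_iff {n : ℕ} (a : Ineq) (x : Fin n → ℝ) :
    a.Holds x ↔ a.functional n x ≤ a.c - a.d := by
  rw [functional_apply, Holds]
  constructor <;> intro h <;> linarith

theorem holds_or_holds_reverse {n : ℕ} (a : Ineq) (x : Fin n → ℝ) :
    a.Holds x ∨ a.reverse.Holds x :=
  le_total _ _

theorem holds_indicatorVec {n : ℕ} (a : Ineq) (I : Finset (Fin n)) :
    a.Holds (indicatorVec I) ↔ a.HoldsAt I := by
  simp only [Holds, HoldsAt, prefixSum_indicatorVec]
  exact_mod_cast Iff.rfl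

end Ineq

/-- The `k`-subsets of `[n]` satisfying the inequalities in `L`. -/
def family (n k : ℕ) (L : List Ineq) : Set (Finset (Fin n)) :=
  {I | I.card = k ∧ ∀ a ∈ L, a.HoldsAt I}

/-- The part of the hypersimplex `Δ_{k,n}` satisfying the inequalities in `L`. -/
def polytope (n k : ℕ) (L : List Ineq) : Set (Fin n → ℝ) :=
  {x | (∀ i, 0 ≤ x i ∧ x i ≤ 1) ∧ ∑ i, x i = k ∧ ∀ a ∈ L, a.Holds x}

theorem convex_polytope (n k : ℕ) (L : List Ineq) : Convex ℝ (polytope n k L) := by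
  rintro x ⟨hx, hxk, hxL⟩ y ⟨hy, hyk, hyL⟩ s t hs ht hst
  refine ⟨fun i => ?_, ?_, fun a ha => ?_⟩
  · exact (convex_Icc (0 : ℝ) 1) (hx i) (hy i) hs ht hst
  · simp only [Pi.add_apply, Pi.smul_apply, smul_eq_mul, Finset.sum_add_distrib,
      ← Finset.mul_sum, hxk, hyk, ← add_mul, hst, one_mul]
  · have h1 := (a.holds_iff x).1 (hxL a ha)
    have h2 := (a.holds_iff y).1 (hyL a ha)
    rw [Ineq.holds_iff]
    exact (convex_halfSpace_le (a.functional n).isLinear _) h1 h2 hs ht hst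

/-- The set of positions at which the integer part of the shifted prefix sums jumps. -/
noncomputable def rounding {n : ℕ} (x : Fin n → ℝ) (t : ℝ) : Finset (Fin n) :=
  Finset.univ.filter fun i => ⌊prefixSum x i + t⌋ < ⌊prefixSum x (i + 1) + t⌋

theorem indicatorVec_rounding {n : ℕ} {x : Fin n → ℝ} (hx : ∀ i, 0 ≤ x i ∧ x i ≤ 1) (t : ℝ)
    (i : Fin n) :
    indicatorVec (rounding x t) i =
      (⌊prefixSum x (i + 1) + t⌋ : ℝ) - ⌊prefixSum x i + t⌋ := by
  have hsucc := prefixSum_succ x i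
  have hlow : ⌊prefixSum x i + t⌋ ≤ ⌊prefixSum x (i + 1) + t⌋ :=
    Int.floor_mono (by linarith [(hx i).1])
  have hhigh : ⌊prefixSum x (i + 1) + t⌋ ≤ ⌊prefixSum x i + t⌋ + 1 := by
    rw [← Int.floor_add_one]
    exact Int.floor_mono (by linarith [(hx i).2])
  simp only [indicatorVec, rounding, Finset.mem_filter, Finset.mem_univ, true_and]
  split_ifs with h
  · rw [le_antisymm hhigh (by omega)]
    push_cast
    ring
  · rw [le_antisymm (not_lt.1 h) hlow, sub_self]

theorem prefixCard_rounding {n : ℕ} {x : Fin n → ℝ} (hx : ∀ i, 0 ≤ x i ∧ x i ≤ 1) {t : ℝ}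
    (ht : t ∈ Set.Ioo (0 : ℝ) 1) (p : ℕ) :
    (prefixCard (rounding x t) p : ℤ) = ⌊prefixSum x p + t⌋ := by
  have key : ∀ p ≤ n, (prefixCard (rounding x t) p : ℤ) = ⌊prefixSum x p + t⌋ := by
    intro p hp
    have := prefixSum_eq_of_succ (x := indicatorVec (rounding x t))
      (g := fun p => (⌊prefixSum x p + t⌋ : ℝ))
      (by simp [prefixSum_zero, Int.floor_eq_zero_iff, ht.1.le, ht.2])
      (indicatorVec_rounding hx t) hp
    rw [prefixSum_indicatorVec] at this
    exact_mod_cast this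
  rcases le_total p n with hp | hp
  · exact key p hp
  · have h1 : prefixCard (rounding x t) p = prefixCard (rounding x t) n := by
      have h := prefixSum_of_le (indicatorVec (rounding x t)) hp
      rw [← prefixSum_of_le _ le_rfl, prefixSum_indicatorVec, prefixSum_indicatorVec] at h
      exact_mod_cast h
    rw [h1, key n le_rfl, prefixSum_of_le x hp, prefixSum_of_le x le_rfl]

theorem rounding_mem_family {n k : ℕ} {L : List Ineq} {x : Fin n → ℝ} (hx : x ∈ polytope n k L)
    {t : ℝ} (ht : t ∈ Set.Ioo (0 : ℝ) 1) : rounding x t ∈ family n k L := by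
  have hcard := prefixCard_rounding hx.1 ht
  refine ⟨?_, fun a ha => ?_⟩
  · have h := hcard n
    have hn : prefixCard (rounding x t) n = (rounding x t).card := by
      rw [prefixCard, Finset.filter_true_of_mem fun i _ => i.isLt]
    rw [hn, prefixSum_of_le x le_rfl, hx.2.1, Int.floor_natCast_add,
      Int.floor_eq_zero_iff.2 ⟨ht.1.le, ht.2⟩] at h
    exact_mod_cast h
  · have h := hx.2.2 a ha
    have : ⌊prefixSum x a.p + t⌋ + a.d ≤ ⌊prefixSum x a.q + t⌋ + (a.c : ℤ) := by
      rw [← Int.floor_add_natCast, ← Int.floor_add_natCast]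
      refine Int.floor_mono ?_
      rw [Ineq.Holds] at h
      linarith
    rw [← hcard, ← hcard] at this
    exact_mod_cast this

/-- A system of bounds on differences of prefix sums cuts out of the hypersimplex a polytope
whose vertices are the indicator vectors it contains. -/
theorem familyPolytope_family (n k : ℕ) (L : List Ineq) :
    familyPolytope n (family n k L) = polytope n k L := by
  apply Set.Subset.antisymm
  · refine convexHull_min ?_ (convex_polytope n k L)
    rintro _ ⟨I, ⟨hk, hL⟩, rfl⟩
    refine ⟨fun i => ?_, ?_, fun a ha => (a.holds_indicatorVec I).2 (hL a ha)⟩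
    · dsimp only
      split_ifs <;> norm_num
    · simp [hk]
  · intro x hx
    let μ : Measure ℝ := volume.restrict (Set.Ioo 0 1)
    have : IsProbabilityMeasure μ := ⟨by simp [μ]⟩
    have hfloor : ∀ s : ℝ, Integrable (fun t : ℝ => (⌊s + t⌋ : ℝ)) μ := fun s => by
      have h : IntervalIntegrable (fun t : ℝ => (⌊s + t⌋ : ℝ)) volume 0 1 :=
        Monotone.intervalIntegrable fun a b hab => by
          exact_mod_cast Int.floor_mono (by linarith : s + a ≤ s + b)
      exact ((intervalIntegrable_iff_integrableOn_Ioc_of_le zero_le_one).1 h).mono_set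
        Set.Ioo_subset_Ioc_self
    have hint : ∀ s : ℝ, ∫ t, (⌊s + t⌋ : ℝ) ∂μ = s := fun s => by
      rw [← integral_Ioc_eq_integral_Ioo, ← intervalIntegral.integral_of_le zero_le_one,
        intervalIntegral_floor_add]
    have hcoord : ∀ i, Integrable (fun t => indicatorVec (rounding x t) i) μ := fun i => by
      simp only [indicatorVec_rounding hx.1]
      exact (hfloor _).sub (hfloor _)
    have hmean : ∫ t, indicatorVec (rounding x t) ∂μ = x := by
      ext i
      rw [eval_integral hcoord]
      simp only [indicatorVec_rounding hx.1]
      rw [integral_sub (hfloor _) (hfloor _), hint, hint, prefixSum_succ]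
      ring
    rw [← hmean]
    refine Convex.integral_mem (convex_convexHull ℝ _) ?_ ?_ (Integrable.of_eval hcoord)
    · refine Set.Finite.isClosed_convexHull ℝ ((Set.finite_range indicatorVec).subset ?_)
      rintro _ ⟨I, -, rfl⟩
      exact ⟨I, rfl⟩
    · refine (ae_restrict_mem measurableSet_Ioo).mono fun t ht => ?_
      exact subset_convexHull ℝ _ ⟨_, rounding_mem_family hx ht, rfl⟩

theorem mem_polytope_append {n k : ℕ} {L L' : List Ineq} {x : Fin n → ℝ} :
    x ∈ polytope n k (L ++ L') ↔ x ∈ polytope n k L ∧ ∀ a ∈ L', a.Holds x := by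
  simp only [polytope, List.mem_append, or_imp, forall_and, Set.mem_ofPred_eq]
  tauto

theorem polytope_inter (n k : ℕ) (L L' : List Ineq) :
    polytope n k L ∩ polytope n k L' = polytope n k (L ++ L') := by
  ext x
  rw [mem_polytope_append, Set.mem_inter_iff]
  exact and_congr_right fun h => ⟨fun h' => h'.2.2, fun h' => ⟨h.1, h.2.1, h'⟩⟩

theorem family_inter (n k : ℕ) (L L' : List Ineq) :
    family n k L ∩ family n k L' = family n k (L ++ L') := by
  ext I
  simp only [family, List.mem_append, or_imp, forall_and, Set.mem_ofPred_eq, Set.mem_inter_iff]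
  tauto

theorem polytope_subset_of_family_subset {n k : ℕ} {L L' : List Ineq}
    (h : family n k L ⊆ family n k L') : polytope n k L ⊆ polytope n k L' := by
  rw [← familyPolytope_family, ← familyPolytope_family]
  exact convexHull_mono fun x ⟨I, hI, hx⟩ => ⟨I, h hI, hx⟩

theorem isExposed_polytope_append_reverse {n k : ℕ} {L T : List Ineq}
    (hT : ∀ a ∈ T, ∀ x ∈ polytope n k L, a.Holds x) :
    IsExposed ℝ (polytope n k L) (polytope n k (L ++ T.map Ineq.reverse)) := by
  rintro ⟨z, hz⟩
  rw [mem_polytope_append] at hz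
  have hle : ∀ a ∈ T, ∀ y ∈ polytope n k L, a.functional n y ≤ a.functional n z := by
    intro a ha y hy
    have h1 := (a.holds_iff y).1 (hT a ha y hy)
    have h2 := hz.2 a.reverse (List.mem_map_of_mem ha)
    rw [Ineq.holds_iff, Ineq.functional_apply] at h2
    rw [a.functional_apply z]
    simp only [Ineq.reverse] at h2
    linarith
  refine ⟨(T.map (Ineq.functional n)).sum, ?_⟩
  have hsum : ∀ (T : List Ineq) (y : Fin n → ℝ),
      (T.map (Ineq.functional n)).sum y = (T.map fun a => a.functional n y).sum := by
    intro T y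
    induction T with
    | nil => simp
    | cons a T ih => simp [ih]
  ext x
  rw [mem_polytope_append]
  refine and_congr_right fun hx => ⟨fun h y hy => ?_, fun h => ?_⟩
  · rw [hsum, hsum]
    refine List.sum_le_sum fun a ha => (hle a ha y hy).trans ?_
    have h1 := (a.holds_iff z).1 (hT a ha z hz.1)
    have h2 := h a.reverse (List.mem_map_of_mem ha)
    rw [Ineq.holds_iff, Ineq.functional_apply] at h2
    rw [a.functional_apply x]
    simp only [Ineq.reverse] at h2
    linarith
  · have hxz := h z hz.1
    rw [hsum, hsum] at hxz
    by_contra! hcon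
    obtain ⟨_, hb, hbx⟩ := hcon
    obtain ⟨a, ha, rfl⟩ := List.mem_map.1 hb
    have hlt : a.functional n x < a.functional n z := by
      refine lt_of_le_of_ne (hle a ha x hx) fun heq => hbx ?_
      have h2 := hz.2 a.reverse (List.mem_map_of_mem ha)
      rw [Ineq.holds_iff, Ineq.functional_apply] at h2 ⊢
      rw [a.functional_apply, a.functional_apply] at heq
      simp only [Ineq.reverse] at h2 ⊢
      linarith
    exact absurd hxz (not_le.2
      (List.sum_lt_sum _ _ (fun b hb => hle b hb x hx) ⟨a, ha, hlt⟩))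


/-- The inequalities cutting the unit cube out of `ℝⁿ`. -/
def box (n : ℕ) : List Ineq :=
  (List.range n).flatMap fun p => [⟨p, p + 1, 0, 0⟩, ⟨p + 1, p, 0, 1⟩]

theorem holds_of_mem_box {n k : ℕ} {L : List Ineq} {x : Fin n → ℝ} (hx : x ∈ polytope n k L)
    {a : Ineq} (ha : a ∈ box n) : a.Holds x := by
  simp only [box, List.mem_flatMap, List.mem_range, List.mem_cons, List.not_mem_nil, or_false] at ha
  obtain ⟨p, hp, rfl | rfl⟩ := ha
  all_goals
    have h := prefixSum_succ x ⟨p, hp⟩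
    have hb := hx.1 ⟨p, hp⟩
    simp only [Ineq.Holds, Nat.cast_zero, Nat.cast_one] at h ⊢
    linarith

theorem finrank_direction_familyPolytope {n k : ℕ} {B : Set (Finset (Fin (n + 1)))}
    (hk : ∀ I ∈ B, I.card = k)
    (hB : ∀ i : Fin (n + 1), i ≠ 0 → ∃ I ∈ B, ∃ J ∈ B,
      indicatorVec I - indicatorVec J = Pi.single i 1 - Pi.single 0 1) :
    Module.finrank ℝ (affineSpan ℝ (familyPolytope (n + 1) B)).direction = n := by
  let total : (Fin (n + 1) → ℝ) →ₗ[ℝ] ℝ := ∑ i, LinearMap.proj i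
  have htotal : ∀ x, total x = ∑ i, x i := fun x => by simp [total]
  have hker : Module.finrank ℝ (LinearMap.ker total) = n := by
    have hsurj : Function.Surjective total := fun r =>
      ⟨Pi.single 0 r, by simp [htotal]⟩
    have := total.finrank_range_add_finrank_ker
    rw [LinearMap.range_eq_top.2 hsurj, finrank_top, Module.finrank_self,
      Module.finrank_fin_fun] at this
    omega
  rw [familyPolytope, affineSpan_convexHull, direction_affineSpan]
  refine Eq.trans (congrArg (fun V : Submodule ℝ (Fin (n + 1) → ℝ) => Module.finrank ℝ V) ?_) hker
  apply le_antisymm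
  · rw [vectorSpan_def, Submodule.span_le]
    rintro _ ⟨_, ⟨I, hI, rfl⟩, _, ⟨J, hJ, rfl⟩, rfl⟩
    have hI' := sum_indicatorVec I
    have hJ' := sum_indicatorVec J
    rw [hk I hI] at hI'
    rw [hk J hJ] at hJ'
    simp only [indicatorVec] at hI' hJ'
    simp only [vsub_eq_sub, SetLike.mem_coe, LinearMap.mem_ker, htotal, Pi.sub_apply,
      Finset.sum_sub_distrib, hI', hJ', sub_self]
  · intro x hx
    have hx0 : ∑ i, x i = 0 := by rw [← htotal]; exact hx
    have hdecomp : x = ∑ i, x i • (Pi.single i (1 : ℝ) - Pi.single 0 1 : Fin (n + 1) → ℝ) := by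
      simp only [smul_sub, Finset.sum_sub_distrib, ← Finset.sum_smul, hx0, zero_smul, sub_zero]
      ext j
      simp [Finset.sum_apply, Pi.single_apply]
    rw [hdecomp]
    refine Submodule.sum_mem _ fun i _ => Submodule.smul_mem _ _ ?_
    by_cases hi : i = 0
    · simp [hi]
    · obtain ⟨I, hI, J, hJ, hIJ⟩ := hB i hi
      rw [← hIJ]
      exact vsub_mem_vectorSpan ℝ ⟨I, hI, rfl⟩ ⟨J, hJ, rfl⟩

theorem pMinor_triple {R : Type*} [CommRing R] {n : ℕ} (A : Matrix (Fin 3) (Fin n) R)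
    {i j k : Fin n} (hij : i < j) (hjk : j < k) :
    pMinor A {i, j, k} = Matrix.det (Matrix.of fun r c => A r (![i, j, k] c)) := by
  have hcard : ({i, j, k} : Finset (Fin n)).card = 3 :=
    Finset.card_eq_three.2 ⟨i, j, k, hij.ne, (hij.trans hjk).ne, hjk.ne, rfl⟩
  have hf : ![i, j, k] = ({i, j, k} : Finset (Fin n)).orderEmbOfFin hcard := by
    refine Finset.orderEmbOfFin_unique hcard (fun c => ?_) ?_
    · fin_cases c <;> simp
    · refine Fin.strictMono_iff_lt_succ.2 fun c => ?_
      fin_cases c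
      · exact hij
      · exact hjk
  rw [pMinor, dif_pos hcard, hf]
  rfl

theorem exists_lt_lt_of_card_eq_three {α : Type*} [LinearOrder α] {I : Finset α}
    (hI : I.card = 3) : ∃ i j k, i < j ∧ j < k ∧ I = {i, j, k} := by
  have hmono := (I.orderEmbOfFin hI).strictMono
  refine ⟨_, _, _, hmono (by decide : (0 : Fin 3) < 1), hmono (by decide : (1 : Fin 3) < 2), ?_⟩
  rw [← Finset.coe_inj, ← Finset.range_orderEmbOfFin I hI]
  ext x
  simp only [Set.mem_range, Fin.exists_fin_succ, Fin.exists_fin_zero, Finset.coe_insert,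
    Finset.coe_singleton, Set.mem_insert_iff, Set.mem_singleton_iff, or_false, eq_comm (a := x)]
  rfl

/-- The number of entries of the triple that are smaller than `p`. -/
def tripleCard (t : ℕ × ℕ × ℕ) (p : ℕ) : ℕ :=
  Nat.add (Nat.sub 1 (Nat.sub t.1.succ p))
    (Nat.add (Nat.sub 1 (Nat.sub t.2.1.succ p)) (Nat.sub 1 (Nat.sub t.2.2.succ p)))

/-- A test whether an inequality holds at a triple of distinct positions. -/
def Ineq.test (a : Ineq) (t : ℕ × ℕ × ℕ) : Bool :=
  Nat.ble (Nat.add (tripleCard t a.p) a.d) (Nat.add (tripleCard t a.q) a.c)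

theorem prefixCard_triple {n : ℕ} {i j k : Fin n} (hij : i ≠ j) (hik : i ≠ k) (hjk : j ≠ k)
    (p : ℕ) : prefixCard {i, j, k} p = tripleCard (i, j, k) p := by
  rw [prefixCard, Finset.card_filter, Finset.sum_insert (by simp [hij, hik]),
    Finset.sum_insert (by simpa using hjk), Finset.sum_singleton]
  have hsub : ∀ m : ℕ, Nat.sub 1 (Nat.sub m.succ p) = if m < p then 1 else 0 := fun m => by
    simp only [Nat.sub_eq, Nat.succ_eq_add_one]
    split_ifs <;> omega
  simp only [tripleCard, hsub, Nat.add_eq]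

theorem Ineq.test_eq_true_iff {n : ℕ} (a : Ineq) {i j k : Fin n} (hij : i ≠ j) (hik : i ≠ k)
    (hjk : j ≠ k) : a.test (i, j, k) = true ↔ a.HoldsAt {i, j, k} := by
  rw [Ineq.test, Nat.ble_eq, Nat.add_eq, Nat.add_eq, Ineq.HoldsAt, prefixCard_triple hij hik hjk,
    prefixCard_triple hij hik hjk]

theorem triple_mem_family_iff {n : ℕ} {L : List Ineq} {i j k : Fin n} (hij : i ≠ j) (hik : i ≠ k)
    (hjk : j ≠ k) :
    {i, j, k} ∈ family n 3 L ↔ (L.all fun a => a.test (i, j, k)) = true := by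
  simp only [family, Set.mem_ofPred_eq, List.all_eq_true, Ineq.test_eq_true_iff _ hij hik hjk,
    Finset.card_eq_three.2 ⟨i, j, k, hij, hik, hjk, rfl⟩, true_and]

/-- The increasing triples of numbers less than `n`. -/
def triples (n : ℕ) : List (ℕ × ℕ × ℕ) :=
  (List.range n).flatMap fun k => (List.range k).flatMap fun j => (List.range j).map fun i =>
    (i, j, k)

theorem mem_triples {n i j k : ℕ} : (i, j, k) ∈ triples n ↔ i < j ∧ j < k ∧ k < n := by
  simp only [triples, List.mem_flatMap, List.mem_map, List.mem_range, Prod.mk.injEq]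
  constructor
  · rintro ⟨k, hk, j, hj, i, hi, rfl, rfl, rfl⟩
    exact ⟨hi, hj, hk⟩
  · rintro ⟨hi, hj, hk⟩
    exact ⟨k, hk, j, hj, i, hi, rfl, rfl, rfl⟩

theorem family_subset_iff {n : ℕ} {L L' : List Ineq} :
    family n 3 L ⊆ family n 3 L' ↔ ∀ t ∈ triples n,
      (L.all fun a => a.test t) = true → (L'.all fun a => a.test t) = true := by
  constructor
  · rintro h ⟨i, j, k⟩ ht hL
    obtain ⟨hij, hjk, hk⟩ := mem_triples.1 ht
    have hne : (⟨i, by omega⟩ : Fin n) ≠ ⟨j, by omega⟩ := by simpa using hij.ne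
    have hne' : (⟨i, by omega⟩ : Fin n) ≠ ⟨k, hk⟩ := by simpa using (hij.trans hjk).ne
    have hne'' : (⟨j, by omega⟩ : Fin n) ≠ ⟨k, hk⟩ := by simpa using hjk.ne
    exact (triple_mem_family_iff hne hne' hne'').1 (h ((triple_mem_family_iff hne hne' hne'').2 hL))
  · intro h I hI
    obtain ⟨i, j, k, hij, hjk, rfl⟩ := exists_lt_lt_of_card_eq_three hI.1
    rw [triple_mem_family_iff hij.ne (hij.trans hjk).ne hjk.ne] at hI ⊢
    exact h _ (mem_triples.2 ⟨hij, hjk, k.isLt⟩) hI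

/-- The list of truth values of `f` along a list, as a binary number. -/
def listMask {α : Type*} (f : α → Bool) : List α → ℕ
  | [] => 0
  | a :: l => (f a).toNat + 2 * listMask f l

theorem listMask_and {α : Type*} (f g : α → Bool) (l : List α) :
    listMask (fun a => f a && g a) l = listMask f l &&& listMask g l := by
  induction l with
  | nil => simp [listMask]
  | cons a l ih =>
    have hbit : ∀ (b : Bool) (m : ℕ), b.toNat + 2 * m = Nat.bit b m := fun b m => by
      cases b <;> simp [Nat.bit, add_comm]
    simp only [listMask, ih, hbit, Nat.land_bit]

theorem listMask_inj {α : Type*} {f g : α → Bool} {l : List α} :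
    listMask f l = listMask g l ↔ ∀ a ∈ l, f a = g a := by
  induction l with
  | nil => simp [listMask]
  | cons a l ih =>
    rw [List.forall_mem_cons, ← ih, listMask, listMask]
    cases f a <;> cases g a <;> simp <;> omega

/-- The set of triples satisfying the inequalities in `L`, as a binary number. -/
def mask (n : ℕ) (L : List Ineq) : ℕ :=
  listMask (fun t => L.all fun a => a.test t) (triples n)

theorem mask_append (n : ℕ) (L L' : List Ineq) : mask n (L ++ L') = mask n L &&& mask n L' := by
  simp only [mask, List.all_append, listMask_and]

theorem family_subset_iff_mask {n : ℕ} {L L' : List Ineq} :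
    family n 3 L ⊆ family n 3 L' ↔ mask n L &&& mask n L' = mask n L := by
  rw [family_subset_iff, mask, mask, ← listMask_and, listMask_inj]
  refine forall₂_congr fun t _ => ?_
  cases (L.all fun a => a.test t) <;> cases (L'.all fun a => a.test t) <;> simp

theorem family_eq_of_mask_eq {n : ℕ} {L L' : List Ineq} (h : mask n L = mask n L') :
    family n 3 L = family n 3 L' :=
  Set.Subset.antisymm (family_subset_iff_mask.2 (by rw [h, Nat.and_self]))
    (family_subset_iff_mask.2 (by rw [h, Nat.and_self]))

/-- `force m f` is `f m`, arranged so that evaluation reduces `m` to a literal first. -/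
def force {β : Type*} (m : ℕ) (f : ℕ → β) : β :=
  Nat.rec (f 0) (fun m _ => f m.succ) m

theorem force_eq {β : Type*} (m : ℕ) (f : ℕ → β) : force m f = f m := by
  cases m <;> rfl

/-- Evaluate a list of numbers before passing it to a function. -/
def forceList {β : Type*} : List ℕ → (List ℕ → β) → β
  | [], f => f []
  | m :: l, f => force m fun m => forceList l fun l => f (m :: l)

theorem forceList_eq {β : Type*} (l : List ℕ) (f : List ℕ → β) : forceList l f = f l := by
  induction l generalizing f with
  | nil => rfl
  | cons m l ih => rw [forceList, force_eq, ih]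

/-- Whether the part of a cell with mask `m` in the set with mask `m'` is a face of it, where `ts`
are the masks of the hyperplanes supporting the cell. -/
def isFaceTest (ts : List ℕ) (m m' : ℕ) : Bool :=
  force (m &&& m') fun i =>
    Nat.beq ((ts.filter fun t => Nat.beq (i &&& t) i).foldr Nat.land m) i

theorem foldr_land_mask (n : ℕ) (L T : List Ineq) :
    (T.map fun a => mask n [a]).foldr Nat.land (mask n L) = mask n (L ++ T) := by
  induction T with
  | nil => simp
  | cons a T ih =>
    rw [List.map_cons, List.foldr_cons, ih, show a :: T = [a] ++ T from rfl, mask_append,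
      mask_append, mask_append]
    exact Nat.and_left_comm _ _ _

/-- The masks of the hyperplanes supporting the polytope defined by `L`. -/
def supportMasks (n : ℕ) (L : List Ineq) : List ℕ :=
  (L ++ box n).map fun a => mask n [a.reverse]

theorem isExposed_inter_of_isFaceTest {n : ℕ} {L L' : List Ineq}
    (h : isFaceTest (supportMasks n L) (mask n L) (mask n L') = true) :
    IsExposed ℝ (familyPolytope n (family n 3 L))
      (familyPolytope n (family n 3 L) ∩ familyPolytope n (family n 3 L')) := by
  rw [isFaceTest, force_eq, Nat.beq_eq, supportMasks, List.filter_map] at h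
  set T := (L ++ box n).filter ((fun t => Nat.beq (mask n L &&& mask n L' &&& t)
    (mask n L &&& mask n L')) ∘ fun a => mask n [a.reverse]) with hT
  have hcomp : (T.map fun a => mask n [a.reverse]) =
      (T.map Ineq.reverse).map fun a => mask n [a] := by
    simp
  rw [hcomp, foldr_land_mask, ← mask_append] at h
  rw [familyPolytope_family, familyPolytope_family, polytope_inter, ← familyPolytope_family n 3 (L ++ L'),
    ← family_eq_of_mask_eq h, familyPolytope_family]
  refine isExposed_polytope_append_reverse fun a ha x hx => ?_
  rcases List.mem_append.1 (List.mem_of_mem_filter ha) with ha | ha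
  · exact hx.2.2 a ha
  · exact holds_of_mem_box hx ha

/-- Whether `m` is contained in a member of the list `cs`, as sets encoded in binary. This is
`List.any`, defined by a bare recursor for the sake of fast evaluation. -/
def subsetTest (m : ℕ) (cs : List ℕ) : Bool :=
  List.rec false (fun c _ b => Bool.rec b true (Nat.beq (Nat.land m c) m)) cs

theorem subsetTest_eq (m : ℕ) (cs : List ℕ) :
    subsetTest m cs = cs.any fun c => Nat.beq (m &&& c) m := by
  induction cs with
  | nil => rfl
  | cons c cs ih =>
    rw [List.any_cons, ← ih]
    change (Bool.rec (subsetTest m cs) true (Nat.beq (m &&& c) m) : Bool) = _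
    cases Nat.beq (m &&& c) m <;> rfl

/-- Whether the set with mask `m`, cut by the listed pairs of opposite half-spaces, falls into
pieces each of which lies in a set with mask in `cs`. -/
def coverTest (cs : List ℕ) : List (ℕ × ℕ) → ℕ → Bool
  | [], m => subsetTest m cs
  | h :: hs, m =>
    force (Nat.land m h.1) fun m₁ => force (Nat.land m h.2) fun m₂ =>
      if Nat.beq m₁ m || Nat.beq m₂ m then coverTest cs hs m
      else subsetTest m cs || (coverTest cs hs m₁ && coverTest cs hs m₂)

theorem exists_mem_polytope_of_coverTest {n : ℕ} (Cs : List (List Ineq)) (hs : List Ineq)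
    (L : List Ineq)
    (h : coverTest (Cs.map (mask n)) (hs.map fun a => (mask n [a], mask n [a.reverse]))
      (mask n L) = true)
    {x : Fin n → ℝ} (hx : x ∈ polytope n 3 L) : ∃ C ∈ Cs, x ∈ polytope n 3 C := by
  have hany : ∀ L : List Ineq, x ∈ polytope n 3 L →
      subsetTest (mask n L) (Cs.map (mask n)) = true →
      ∃ C ∈ Cs, x ∈ polytope n 3 C := by
    intro L hx h
    rw [subsetTest_eq] at h
    obtain ⟨_, hc, h⟩ := List.any_eq_true.1 h
    obtain ⟨C, hC, rfl⟩ := List.mem_map.1 hc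
    exact ⟨C, hC, polytope_subset_of_family_subset
      (family_subset_iff_mask.2 (Nat.eq_of_beq_eq_true h)) hx⟩
  induction hs generalizing L with
  | nil => exact hany L hx h
  | cons a hs ih =>
    rw [List.map_cons, coverTest, force_eq, force_eq] at h
    split_ifs at h with hskip
    · exact ih L h hx
    · rw [Bool.or_eq_true, Bool.and_eq_true] at h
      change _ ∨ coverTest _ _ (mask n L &&& _) = true ∧
        coverTest _ _ (mask n L &&& _) = true at h
      rw [← mask_append, ← mask_append] at h
      rcases h with h | ⟨h₁, h₂⟩
      · exact hany L hx h
      · rcases a.holds_or_holds_reverse x with ha | ha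
        · exact ih _ h₁ (mem_polytope_append.2 ⟨hx, by simpa using ha⟩)
        · exact ih _ h₂ (mem_polytope_append.2 ⟨hx, by simpa using ha⟩)

/-- The positive terms of the determinant of three vectors. -/
def detPos : ℕ × ℕ × ℕ → ℕ × ℕ × ℕ → ℕ × ℕ × ℕ → ℕ
  | (a₀, a₁, a₂), (b₀, b₁, b₂), (c₀, c₁, c₂) => a₀ * b₁ * c₂ + b₀ * c₁ * a₂ + c₀ * a₁ * b₂

/-- The negative terms of the determinant of three vectors. -/
def detNeg : ℕ × ℕ × ℕ → ℕ × ℕ × ℕ → ℕ × ℕ × ℕ → ℕ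
  | (a₀, a₁, a₂), (b₀, b₁, b₂), (c₀, c₁, c₂) => a₂ * b₁ * c₀ + b₂ * c₁ * a₀ + c₂ * a₁ * b₀

/-- Whether the vectors `col p` realize the family defined by `L` as a positroid. -/
def positroidTest (n : ℕ) (L : List Ineq) (col : ℕ → ℕ × ℕ × ℕ) : Bool :=
  (triples n).all fun t =>
    force (detPos (col t.1) (col t.2.1) (col t.2.2)) fun x =>
      force (detNeg (col t.1) (col t.2.1) (col t.2.2)) fun y =>
        Nat.ble y x && (Nat.blt y x == L.all fun a => a.test t)

theorem isPositroidFamily_of_positroidTest {n : ℕ} {L : List Ineq} {col : ℕ → ℕ × ℕ × ℕ}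
    (h : positroidTest n L col = true) : IsPositroidFamily n 3 (family n 3 L) := by
  let A : Matrix (Fin 3) (Fin n) ℝ :=
    Matrix.of fun r i => ![((col i).1 : ℝ), (col i).2.1, (col i).2.2] r
  have hminor : ∀ i j k : Fin n, i < j → j < k →
      pMinor A {i, j, k} = (detPos (col i) (col j) (col k) : ℝ) - detNeg (col i) (col j) (col k) := by
    intro i j k hij hjk
    rw [pMinor_triple A hij hjk, Matrix.det_fin_three]
    simp [A, detPos, detNeg]
    ring
  have htest : ∀ i j k : Fin n, i < j → j < k →
      0 ≤ pMinor A {i, j, k} ∧ ({i, j, k} ∈ family n 3 L ↔ pMinor A {i, j, k} ≠ 0) := by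
    intro i j k hij hjk
    have ht := List.all_eq_true.1 h (i, j, k) (mem_triples.2 ⟨hij, hjk, k.isLt⟩)
    simp only [force_eq, Bool.and_eq_true, beq_iff_eq, Nat.ble_eq] at ht
    rw [hminor i j k hij hjk, triple_mem_family_iff hij.ne (hij.trans hjk).ne hjk.ne, ← ht.2,
      Nat.blt_eq, sub_ne_zero, Ne, Nat.cast_inj]
    exact ⟨sub_nonneg.2 (by exact_mod_cast ht.1), by have := ht.1; omega⟩
  refine ⟨A, fun I hI => ?_, fun I => ⟨fun hI => ⟨hI.1, ?_⟩, fun ⟨hI, hne⟩ => ?_⟩⟩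
  · obtain ⟨i, j, k, hij, hjk, rfl⟩ := exists_lt_lt_of_card_eq_three hI
    exact (htest i j k hij hjk).1
  · obtain ⟨i, j, k, hij, hjk, rfl⟩ := exists_lt_lt_of_card_eq_three hI.1
    exact (htest i j k hij hjk).2.1 hI
  · obtain ⟨i, j, k, hij, hjk, rfl⟩ := exists_lt_lt_of_card_eq_three hI
    exact (htest i j k hij hjk).2.2 hne

/-- Whether each position can be exchanged with position `0` within the family defined by `L`
on `n + 1` positions. -/
def exchangeTest (n : ℕ) (L : List Ineq) : Bool :=
  (List.range n).all fun i => (triples (n + 1)).any fun t =>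
    Nat.beq t.1 0 && !Nat.beq t.2.1 (i + 1) && !Nat.beq t.2.2 (i + 1) &&
      (L.all fun a => a.test t) && L.all fun a => a.test (i + 1, t.2)

theorem finrank_direction_of_exchangeTest {n : ℕ} {L : List Ineq} (h : exchangeTest n L = true) :
    Module.finrank ℝ
      (affineSpan ℝ (familyPolytope (n + 1) (family (n + 1) 3 L))).direction = n := by
  refine finrank_direction_familyPolytope (k := 3) (fun I hI => hI.1) fun i hi => ?_
  obtain ⟨i, rfl⟩ := Fin.exists_succ_eq.2 hi
  obtain ⟨⟨z, j, k⟩, ht, h⟩ :=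
    List.any_eq_true.1 (List.all_eq_true.1 h i (List.mem_range.2 i.isLt))
  obtain ⟨hzj, hjk, hk⟩ := mem_triples.1 ht
  simp only [Bool.and_eq_true, Bool.not_eq_true', Nat.beq_eq, ← Bool.not_eq_true] at h
  obtain ⟨⟨⟨⟨rfl, hji⟩, hki⟩, h0⟩, hi'⟩ := h
  have hj0 : (0 : Fin (n + 1)) ≠ ⟨j, by omega⟩ := by simpa [Fin.ext_iff] using hzj.ne
  have hk0 : (0 : Fin (n + 1)) ≠ ⟨k, hk⟩ := by simpa [Fin.ext_iff] using (hzj.trans hjk).ne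
  have hjk' : (⟨j, by omega⟩ : Fin (n + 1)) ≠ ⟨k, hk⟩ := by simpa using hjk.ne
  have hij : i.succ ≠ ⟨j, by omega⟩ := by simpa [Fin.ext_iff, eq_comm] using hji
  have hik : i.succ ≠ ⟨k, hk⟩ := by simpa [Fin.ext_iff, eq_comm] using hki
  refine ⟨_, (triple_mem_family_iff hij hik hjk').2 hi', _,
    (triple_mem_family_iff hj0 hk0 hjk').2 h0, ?_⟩
  ext m
  simp only [indicatorVec, Pi.sub_apply, Finset.mem_insert, Finset.mem_singleton, Pi.single_apply]
  by_cases hmj : m = ⟨j, by omega⟩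
  · subst hmj; simp [hij.symm, hj0.symm]
  · by_cases hmk : m = ⟨k, hk⟩
    · subst hmk; simp [hik.symm, hk0.symm]
    · simp [hmj, hmk]

/-- The inequality bounding by `c` the sum of the coordinates in the cyclic interval
`{p, …, q - 1}` of `[12]`, for points of `Δ_{3,12}`. -/
def arcLE (p q c : ℕ) : Ineq :=
  if Nat.ble (p % 12) (q % 12) then ⟨q % 12, p % 12, 0, c⟩ else ⟨q % 12, p % 12, 3, c⟩

/-- The inequality bounding the same sum by `c` from below. -/
def arcGE (p q c : ℕ) : Ineq := (arcLE p q c).reverse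

/-- A positroid given by the inequalities defining its polytope and by a realization. -/
structure Cell where
  facets : List Ineq
  col : ℕ → ℕ × ℕ × ℕ

/-- The positroid of three parallel classes, which are the cyclic intervals between `u`, `v` and
`w`, and of generic elements `v` and `w` on two of the lines joining them. -/
def crossing (u v w : ℕ) : Cell where
  facets := [arcLE u v 1, arcGE u (v + 1) 1, arcLE (v + 1) w 1, arcLE (w + 1) u 1, arcGE w u 1]
  col p :=
    let x := (p + 12 - u % 12) % 12
    let y := (v + 12 - u % 12) % 12
    let z := (w + 12 - u % 12) % 12
    if Nat.blt x y then (1, 0, 0) else if Nat.beq x y then (1, 1, 0)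
    else if Nat.blt x z then (0, 1, 0) else if Nat.beq x z then (0, 1, 1) else (0, 0, 1)

/-- The positroid with a generic element `2`, `6`, `10` on each of three lines. -/
def hub : Cell where
  facets := [arcLE 3 6 1, arcLE 7 10 1, arcLE 11 2 1, arcLE 11 6 2, arcLE 3 10 2, arcLE 7 2 2]
  col p := [(1, 0, 0), (1, 0, 0), (1, 1, 0), (0, 1, 0), (0, 1, 0), (0, 1, 0), (0, 1, 1), (0, 0, 1),
    (0, 0, 1), (0, 0, 1), (1, 0, 1), (1, 0, 0)].getD p (0, 0, 0)

/-- The positroid in which the seven elements outside `{r, …, r + 4}` are parallel, `r, …, r + t - 1`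
are parallel and the remaining elements except for `r + t` are collinear. -/
def outer (r t : ℕ) : Cell where
  facets := [arcLE (r + 5) r 1, arcLE r (r + t) 1, arcGE r (r + t + 1) 1]
  col p :=
    let x := (p + 12 - r) % 12
    if Nat.blt x t then (1, 0, 0) else if Nat.beq x t then (1, 1, 0)
    else if Nat.blt x 5 then (0, 1, x - t) else (0, 0, 1)

/-- The cells of the subdivision. Position `r + s` with `r ∈ {0, 4, 8}` and `s ∈ {1, 2, 3}` stands
for one of three pseudolines in one of three parallel classes, and the cells `crossing` are the
crossings in a nonstretchable arrangement of these nine pseudolines. -/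
def cells : List Cell :=
  hub :: ([(12, 1, 5), (11, 1, 6), (11, 1, 7), (12, 2, 5), (9, 2, 7), (10, 3, 5), (10, 3, 6),
      (9, 3, 7)].flatMap fun (u, v, w) => [0, 4, 8].map fun r => crossing (u + r) (v + r) (w + r)) ++
    [0, 4, 8].flatMap fun r => [1, 2, 3].map fun t => outer r t

theorem cells_positroidTest : (cells.all fun C => positroidTest 12 C.facets C.col) = true := by
  decide +kernel

theorem cells_exchangeTest : (cells.all fun C => exchangeTest 11 C.facets) = true := by
  decide +kernel

/-- Whether any two of the listed cells meet in a common face. -/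
def facesTest (n : ℕ) (Ls : List (List Ineq)) : Bool :=
  forceList (Ls.map (mask n)) fun ms =>
    Ls.all fun L => force (mask n L) fun m => forceList (supportMasks n L) fun ts =>
      ms.all fun m' => isFaceTest ts m m'

theorem isFaceTest_of_facesTest {n : ℕ} {Ls : List (List Ineq)} (h : facesTest n Ls = true)
    {L L' : List Ineq} (hL : L ∈ Ls) (hL' : L' ∈ Ls) :
    isFaceTest (supportMasks n L) (mask n L) (mask n L') = true := by
  simp only [facesTest, forceList_eq, force_eq, List.all_eq_true] at h
  exact h L hL _ (List.mem_map_of_mem hL')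

theorem cells_facesTest : facesTest 12 (cells.map Cell.facets) = true := by
  decide +kernel

/-- Hyperplanes cutting the hypersimplex into pieces contained in single cells. -/
def walls : List Ineq :=
  [(2, 8), (7, 11), (9, 4), (3, 6), (5, 0), (2, 7), (10, 4), (8, 10), (1, 8), (0, 2), (4, 6),
    (3, 5), (11, 2), (11, 3), (0, 3), (11, 1), (6, 11), (7, 9), (10, 2), (9, 3), (6, 0), (7, 10),
    (6, 10), (8, 11), (3, 7), (2, 6), (4, 7), (1, 6), (5, 10), (5, 11), (2, 5), (1, 7), (8, 0),
    (10, 1), (6, 9), (9, 2), (4, 8), (0, 4), (10, 3)].map fun (p, q) => arcLE p q 1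

/-- `coverTest` for the hypersimplex, the cells in `Ls` and the hyperplanes in `hs`. -/
def hypersimplexCoverTest (n : ℕ) (Ls : List (List Ineq)) (hs : List Ineq) : Bool :=
  forceList (Ls.map (mask n)) fun ms =>
    forceList (hs.map fun a => mask n [a]) fun ts =>
      forceList (hs.map fun a => mask n [a.reverse]) fun ts' =>
        force (mask n []) fun m => coverTest ms (ts.zip ts') m

theorem exists_mem_polytope_of_hypersimplexCoverTest {n : ℕ} {Ls : List (List Ineq)}
    {hs : List Ineq} (h : hypersimplexCoverTest n Ls hs = true) {x : Fin n → ℝ}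
    (hx : x ∈ polytope n 3 []) : ∃ L ∈ Ls, x ∈ polytope n 3 L := by
  simp only [hypersimplexCoverTest, forceList_eq, force_eq, List.zip_map'] at h
  exact exists_mem_polytope_of_coverTest Ls hs [] h hx

theorem cells_hypersimplexCoverTest :
    hypersimplexCoverTest 12 (cells.map Cell.facets) walls = true := by
  decide +kernel

theorem sum_lt_sum_of_mem_faceOf {n k : ℕ} {P : Finset (Fin n) → ℝ} {lam : Fin n → ℝ}
    {I₁ I₂ I₃ J₁ J₂ J₃ : Finset (Fin n)} (hI₁ : I₁ ∈ FaceOf n k P lam)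
    (hI₂ : I₂ ∈ FaceOf n k P lam) (hI₃ : I₃ ∈ FaceOf n k P lam) (hJ₁ : J₁ ∈ FaceOf n k P lam)
    (hJ₂ : J₂ ∈ FaceOf n k P lam) (hJ₃ : J₃ ∉ FaceOf n k P lam) (hJ₃k : J₃.card = k)
    (hIJ : I₁.val + I₂.val + I₃.val = J₁.val + J₂.val + J₃.val) :
    P I₁ + P I₂ + P I₃ < P J₁ + P J₂ + P J₃ := by
  have hsum := congrArg (fun s => (s.map lam).sum) hIJ
  simp only [Multiset.map_add, Multiset.sum_add] at hsum
  change ∑ i ∈ I₁, lam i + ∑ i ∈ I₂, lam i + ∑ i ∈ I₃, lam i =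
    ∑ i ∈ J₁, lam i + ∑ i ∈ J₂, lam i + ∑ i ∈ J₃, lam i at hsum
  have h₁ := hJ₁.2 I₁ hI₁.1
  have h₂ := hJ₂.2 I₂ hI₂.1
  have h₁' := hI₁.2 J₁ hJ₁.1
  have h₂' := hI₂.2 J₂ hJ₂.1
  have h₃ : ∑ i ∈ J₃, lam i - P J₃ < ∑ i ∈ I₃, lam i - P I₃ := by
    by_contra! h
    exact hJ₃ ⟨hJ₃k, fun K hK => (hI₃.2 K hK).trans h⟩
  linarith

instance (n k : ℕ) (L : List Ineq) (I : Finset (Fin n)) : Decidable (I ∈ family n k L) :=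
  inferInstanceAs (Decidable (_ ∧ _))

/-- The families of bases of the cells. -/
def subdivision : Set (Set (Finset (Fin 12))) :=
  {B | ∃ C ∈ cells, B = family 12 3 C.facets}

/-- The subdivision is not regular: each of the six crossings yields an inequality between values
of the height function, and the six inequalities contradict each other. -/
theorem not_forall_faceOf (P : Finset (Fin 12) → ℝ) :
    ¬ ∀ B ∈ subdivision, ∃ lam : Fin 12 → ℝ, B = FaceOf 12 3 P lam := by
  intro h
  have hlt : ∀ (u v w : ℕ) (I₁ I₂ I₃ J₁ J₂ J₃ : Finset (Fin 12)),
      crossing u v w ∈ cells →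
      (I₁ ∈ family 12 3 (crossing u v w).facets ∧ I₂ ∈ family 12 3 (crossing u v w).facets ∧
        I₃ ∈ family 12 3 (crossing u v w).facets ∧ J₁ ∈ family 12 3 (crossing u v w).facets ∧
        J₂ ∈ family 12 3 (crossing u v w).facets ∧ J₃ ∉ family 12 3 (crossing u v w).facets ∧
        J₃.card = 3 ∧ I₁.val + I₂.val + I₃.val = J₁.val + J₂.val + J₃.val) →
      P I₁ + P I₂ + P I₃ < P J₁ + P J₂ + P J₃ := by
    rintro u v w I₁ I₂ I₃ J₁ J₂ J₃ hC ⟨hI₁, hI₂, hI₃, hJ₁, hJ₂, hJ₃, hk, hIJ⟩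
    obtain ⟨lam, hlam⟩ := h _ ⟨_, hC, rfl⟩
    rw [hlam] at hI₁ hI₂ hI₃ hJ₁ hJ₂ hJ₃
    exact sum_lt_sum_of_mem_faceOf hI₁ hI₂ hI₃ hJ₁ hJ₂ hJ₃ hk hIJ
  have h₁₂ := hlt 11 1 6 {0, 1, 8} {0, 4, 6} {4, 8, 11} {1, 4, 8} {0, 6, 8} {0, 4, 11}
    (by simp [cells]) (by decide +kernel)
  have h₂₃ := hlt 9 2 7 {0, 2, 8} {0, 4, 7} {4, 8, 9} {2, 4, 8} {0, 7, 8} {0, 4, 9}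
    (by simp [cells]) (by decide +kernel)
  have h₃₁ := hlt 10 3 5 {0, 3, 8} {0, 4, 5} {4, 8, 10} {3, 4, 8} {0, 5, 8} {0, 4, 10}
    (by simp [cells]) (by decide +kernel)
  have h₁₃ := hlt 11 1 7 {1, 4, 8} {0, 7, 8} {0, 4, 10} {0, 1, 8} {0, 4, 7} {4, 8, 10}
    (by simp [cells]) (by decide +kernel)
  have h₂₁ := hlt 12 2 5 {2, 4, 8} {0, 5, 8} {0, 4, 11} {0, 2, 8} {0, 4, 5} {4, 8, 11}
    (by simp [cells]) (by decide +kernel)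
  have h₃₂ := hlt 10 3 6 {3, 4, 8} {0, 6, 8} {0, 4, 9} {0, 3, 8} {0, 4, 6} {4, 8, 9}
    (by simp [cells]) (by decide +kernel)
  linarith

end Alcoved

open Alcoved in
/-- There exists a nonregular positroidal subdivision of the hypersimplex `Δ_{3,12}`. -/
theorem stmt_16 :
    ∃ 𝒞 : Set (Set (Finset (Fin 12))),
      𝒞.Finite ∧
      (∀ B ∈ 𝒞, IsPositroidFamily 12 3 B ∧
        Module.finrank ℝ (affineSpan ℝ (familyPolytope 12 B)).direction = 11) ∧
      (⋃ B ∈ 𝒞, familyPolytope 12 B) =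
        familyPolytope 12 {I : Finset (Fin 12) | I.card = 3} ∧
      (∀ B ∈ 𝒞, ∀ B' ∈ 𝒞,
        familyPolytope 12 B ∩ familyPolytope 12 B' = familyPolytope 12 (B ∩ B') ∧
        IsExposed ℝ (familyPolytope 12 B) (familyPolytope 12 B ∩ familyPolytope 12 B') ∧
        IsExposed ℝ (familyPolytope 12 B') (familyPolytope 12 B ∩ familyPolytope 12 B')) ∧
      ¬ ∃ P : Finset (Fin 12) → ℝ,
        𝒞 = {ℬ : Set (Finset (Fin 12)) |
          (∃ lam : Fin 12 → ℝ, ℬ = FaceOf 12 3 P lam) ∧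
          Module.finrank ℝ (affineSpan ℝ (familyPolytope 12 ℬ)).direction = 11} := by
  have hexposed : ∀ C ∈ cells, ∀ C' ∈ cells, IsExposed ℝ (familyPolytope 12 (family 12 3 C.facets))
      (familyPolytope 12 (family 12 3 C.facets) ∩ familyPolytope 12 (family 12 3 C'.facets)) :=
    fun C hC C' hC' => isExposed_inter_of_isFaceTest
      (isFaceTest_of_facesTest cells_facesTest (List.mem_map_of_mem hC) (List.mem_map_of_mem hC'))
  have hΔ : {I : Finset (Fin 12) | I.card = 3} = family 12 3 [] := by
    ext I
    simp [family]
  refine ⟨subdivision, ?_, ?_, ?_, ?_, ?_⟩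
  · refine ((List.finite_toSet cells).image fun C => family 12 3 C.facets).subset ?_
    rintro _ ⟨C, hC, rfl⟩
    exact ⟨C, hC, rfl⟩
  · rintro _ ⟨C, hC, rfl⟩
    exact ⟨isPositroidFamily_of_positroidTest (List.all_eq_true.1 cells_positroidTest C hC),
      finrank_direction_of_exchangeTest (List.all_eq_true.1 cells_exchangeTest C hC)⟩
  · rw [hΔ, familyPolytope_family]
    refine Set.Subset.antisymm (Set.iUnion₂_subset ?_) fun x hx => ?_
    · rintro _ ⟨C, -, rfl⟩
      rw [familyPolytope_family]
      exact fun x hx => ⟨hx.1, hx.2.1, by simp⟩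
    · obtain ⟨_, hL, hxL⟩ :=
        exists_mem_polytope_of_hypersimplexCoverTest cells_hypersimplexCoverTest hx
      obtain ⟨C, hC, rfl⟩ := List.mem_map.1 hL
      rw [← familyPolytope_family] at hxL
      exact Set.mem_biUnion ⟨C, hC, rfl⟩ hxL
  · rintro _ ⟨C, hC, rfl⟩ _ ⟨C', hC', rfl⟩
    refine ⟨?_, hexposed C hC C' hC', ?_⟩
    · rw [family_inter, familyPolytope_family, familyPolytope_family, familyPolytope_family,
        polytope_inter]
    · rw [Set.inter_comm]
      exact hexposed C' hC' C hC
  · rintro ⟨P, hP⟩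
    exact not_forall_faceOf P fun B hB => (hP ▸ hB : _ ∈ {ℬ : Set (Finset (Fin 12)) | _}).1
end

section
/- Let 0 < k < n and let A be a k×n matrix over the field 𝕂 = HahnSeries ℝ ℝ such that every maximal minor p_I(A) is nonzero with positive leading coefficient. Then the function P(I) := ord(p_I(A)) on k-element subsets of [n] is a positive tropical Plücker vector: for every (k−2)-element subset S of [n] and all a < b < c < d in [n] ∖ S, either P(S∪{a,c}) + P(S∪{b,d}) = P(S∪{a,b}) + P(S∪{c,d}) ≤ P(S∪{a,d}) + P(S∪{b,c}) or P(S∪{a,c}) + P(S∪{b,d}) = P(S∪{a,d}) + P(S∪{b,c}) ≤ P(S∪{a,b}) + P(S∪{c,d}). -/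
/-- The order (valuation) of a Hahn series with real exponents. -/
noncomputable def ord (f : HahnSeries ℝ ℝ) : ℝ := f.order

/-- The leading coefficient of a Hahn series. -/
noncomputable def lc (f : HahnSeries ℝ ℝ) : ℝ := f.leadingCoeff

/-- Three-term Plücker relation for determinants whose rows other than the first two are fixed. -/
theorem det_vecCons_three_term {R : Type*} [CommRing R] {m : ℕ}
    (s : Fin m → Fin (m + 2) → R) (x y z w : Fin (m + 2) → R) :
    Matrix.det (Matrix.vecCons x (Matrix.vecCons z s)) *
        Matrix.det (Matrix.vecCons y (Matrix.vecCons w s)) =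
      Matrix.det (Matrix.vecCons x (Matrix.vecCons y s)) *
          Matrix.det (Matrix.vecCons z (Matrix.vecCons w s)) +
        Matrix.det (Matrix.vecCons x (Matrix.vecCons w s)) *
          Matrix.det (Matrix.vecCons y (Matrix.vecCons z s)) := by
  let D : (Fin (m + 2) → R) → (Fin (m + 2) → R) → R :=
    fun u v => Matrix.detRowAlternating (Matrix.vecCons u (Matrix.vecCons v s))
  change D x z * D y w = D x y * D z w + D x w * D y z
  let M : Matrix (Fin (m + 2)) (Fin (m + 2)) R := Matrix.vecCons x (Matrix.vecCons y s)
  let L : (Fin (m + 2) → R) →ₗ[R] R :=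
    Matrix.detRowAlternating.toMultilinearMap.toLinearMap
      (Matrix.vecCons 0 (Matrix.vecCons w s)) 0
  have hL (u) : L u = D u w := by
    simp only [L, D, MultilinearMap.toLinearMap_apply]
    refine congrArg Matrix.detRowAlternating (funext fun i => ?_)
    refine Fin.cases ?_ (fun i => ?_) i <;> simp
  have hLs (j : Fin m) : L (s j) = 0 := by
    rw [hL]
    refine Matrix.detRowAlternating.map_eq_zero_of_eq _ (i := 0) (j := j.succ.succ) ?_ ?_
    · simp
    · exact (Fin.succ_ne_zero _).symm
  have hcramer := congrArg L (Matrix.mulVec_cramer M.transpose z)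
  have h0 : Matrix.cramer M.transpose z 0 = D z y := by
    rw [Matrix.cramer_transpose_apply]
    change Matrix.det _ = Matrix.det _
    refine congrArg Matrix.det (funext fun i => ?_)
    refine Fin.cases Matrix.updateRow_self (fun i => ?_) i
    rw [Matrix.updateRow_ne (Fin.succ_ne_zero i)]
    rfl
  have h1 : Matrix.cramer M.transpose z 1 = D x z := by
    rw [Matrix.cramer_transpose_apply]
    change Matrix.det _ = Matrix.det _
    refine congrArg Matrix.det (funext fun i => ?_)
    refine Fin.cases ?_ (fun i => Fin.cases Matrix.updateRow_self (fun i => ?_) i) i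
    · rw [Matrix.updateRow_ne (by simp)]
      rfl
    · rw [Matrix.updateRow_ne (by simp [Fin.ext_iff])]
      rfl
  have hswap : D z y = -D y z := by
    have h := Matrix.detRowAlternating.map_swap (Matrix.vecCons y (Matrix.vecCons z s))
      (i := 0) (j := 1) (by simp)
    rw [← h]
    change Matrix.detRowAlternating _ = Matrix.detRowAlternating _
    congr 1
    ext i
    refine Fin.cases ?_ (fun i => Fin.cases ?_ (fun i => ?_) i) i
    · simp
    · simp
    · rw [Function.comp_apply, Equiv.swap_apply_of_ne_of_ne] <;> simp [Fin.ext_iff]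
  have hM2 (j : Fin m) : M.transpose.transpose j.succ.succ = s j := rfl
  have hdet : M.transpose.det = D x y := Matrix.det_transpose M
  rw [Matrix.mulVec_eq_sum, map_sum, Fin.sum_univ_succ, Fin.sum_univ_succ, Fin.succ_zero_eq_one]
    at hcramer
  simp only [op_smul_eq_smul, map_smul, smul_eq_mul, hM2, hLs, mul_zero, Finset.sum_const_zero,
    h0, h1, hswap, hdet] at hcramer
  simp only [hL] at hcramer
  change -D y z * D x w + (D x z * D y w + 0) = _ at hcramer
  linear_combination hcramer

/-- A maximal minor computed from an arbitrary enumeration of the columns; the sign of the sorting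
permutation is that of the Vandermonde product. -/
theorem pMinor_eq_sign_mul_det {R : Type*} [CommRing R] {k n : ℕ}
    (A : Matrix (Fin k) (Fin n) R) {I : Finset (Fin n)} (hI : I.card = k) {f : Fin k → Fin n}
    (hf : Function.Injective f) (hfI : ∀ i, f i ∈ I) :
    pMinor A I =
      (Int.sign (∏ i, ∏ j ∈ Finset.Ioi i, (((f j : ℕ) : ℤ) - ((f i : ℕ) : ℤ))) : R) *
        (A.submatrix id f).det := by
  have hmono : StrictMono (f ∘ Tuple.sort f) :=
    (Tuple.monotone_sort f).strictMono_of_injective (hf.comp (Tuple.sort f).injective)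
  have hsort : f ∘ Tuple.sort f = I.orderEmbOfFin hI :=
    Finset.orderEmbOfFin_unique hI (fun i => hfI _) hmono
  have hdet : pMinor A I = ((Equiv.Perm.sign (Tuple.sort f) : ℤ) : R) *
      (A.submatrix id f).det := by
    rw [pMinor, dif_pos hI, ← Matrix.det_permute']
    congr 1
    ext r c
    simp [← hsort]
  have hvand (g : Fin k → Fin n) :
      (Matrix.vandermonde fun i => ((g i : ℕ) : ℤ)).det =
        ∏ i, ∏ j ∈ Finset.Ioi i, (((g j : ℕ) : ℤ) - ((g i : ℕ) : ℤ)) :=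
    Matrix.det_vandermonde _
  have hpos : 0 < (Equiv.Perm.sign (Tuple.sort f) : ℤ) *
      ∏ i, ∏ j ∈ Finset.Ioi i, (((f j : ℕ) : ℤ) - ((f i : ℕ) : ℤ)) := by
    rw [← hvand f]
    have hperm := Matrix.det_permute (Tuple.sort f) (Matrix.vandermonde fun i => ((f i : ℕ) : ℤ))
    rw [Int.cast_id] at hperm
    rw [← hperm]
    change 0 < (Matrix.vandermonde fun i => (((f ∘ Tuple.sort f) i : ℕ) : ℤ)).det
    rw [hvand]
    refine Finset.prod_pos fun i _ => Finset.prod_pos fun j hj => ?_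
    have := hmono (Finset.mem_Ioi.1 hj)
    rw [Fin.lt_def] at this
    omega
  rw [hdet]
  congr 2
  rcases Int.units_eq_one_or (Equiv.Perm.sign (Tuple.sort f)) with h | h <;> rw [h] at hpos ⊢
  · rw [Int.sign_eq_one_of_pos (by simpa using hpos)]; rfl
  · rw [Int.sign_eq_neg_one_of_neg (by simpa using hpos)]; rfl

/-- Up to a rescaling of the columns, the maximal minors on `S ∪ {u, v}` with `u < v` are the
determinants with first columns `u`, `v`, followed by the columns in `S`. -/
theorem pMinor_union_pair {R : Type*} [CommRing R] {m n : ℕ}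
    (A : Matrix (Fin (m + 2)) (Fin n) R) {S : Finset (Fin n)} (hS : S.card = m)
    {u v : Fin n} (huv : u < v) (hu : u ∉ S) (hv : v ∉ S) :
    pMinor A (S ∪ {u, v}) =
      (Int.sign (∏ i, (((S.orderEmbOfFin hS i : ℕ) : ℤ) - ((u : ℕ) : ℤ))) : R) *
        (Int.sign (∏ i, (((S.orderEmbOfFin hS i : ℕ) : ℤ) - ((v : ℕ) : ℤ))) : R) *
        Matrix.det (Matrix.vecCons (A.transpose u) (Matrix.vecCons (A.transpose v)
          fun i => A.transpose (S.orderEmbOfFin hS i))) := by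
  have hmem (i) : S.orderEmbOfFin hS i ∈ S := Finset.orderEmbOfFin_mem S hS i
  have hcard : (S ∪ {u, v}).card = m + 2 := by
    rw [Finset.card_union_of_disjoint (by simp [hu, hv]), Finset.card_pair huv.ne, hS]
  rw [pMinor_eq_sign_mul_det A hcard
    (f := Matrix.vecCons u (Matrix.vecCons v (S.orderEmbOfFin hS))) ?_ ?_]
  · congr 1
    · rw [Fin.prod_univ_succ, Fin.prod_univ_succ]
      simp only [Fin.prod_Ioi_zero, Fin.prod_Ioi_succ, Fin.prod_univ_succ, Matrix.cons_val_zero,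
        Matrix.cons_val_succ, Int.sign_mul]
      rw [Int.sign_eq_one_of_pos (a := ((v : ℕ) : ℤ) - ((u : ℕ) : ℤ))
          (by rw [Fin.lt_def] at huv; omega),
        Int.sign_eq_one_of_pos (a := ∏ i, ∏ j ∈ Finset.Ioi i, _)]
      · push_cast; ring
      · refine Finset.prod_pos fun i _ => Finset.prod_pos fun j hj => ?_
        have := (S.orderEmbOfFin hS).strictMono (Finset.mem_Ioi.1 hj)
        rw [Fin.lt_def] at this
        omega
    · rw [← Matrix.det_transpose]
      congr 1
      ext i j
      refine Fin.cases ?_ (fun i => Fin.cases ?_ (fun i => ?_) i) i <;> simp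
  · have hs (w) (hw : w ∉ S) : w ∉ Set.range (S.orderEmbOfFin hS) := by
      rintro ⟨i, rfl⟩
      exact hw (hmem i)
    refine (Fin.cons_injective_iff (α := Fin n)).2 ⟨?_, Fin.cons_injective_iff.2
      ⟨hs v hv, (S.orderEmbOfFin hS).injective⟩⟩
    rintro ⟨i, hi⟩
    revert hi
    refine Fin.cases ?_ (fun i => ?_) i
    · intro hi
      exact huv.ne' hi
    · intro hi
      exact hs u hu ⟨i, hi⟩
  · intro i
    refine Fin.cases ?_ (fun i => Fin.cases ?_ (fun i => ?_) i) i <;> simp [hmem]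

/-- The three-term Plücker relation for maximal minors. -/
theorem pMinor_three_term {R : Type*} [CommRing R] {k n : ℕ}
    (A : Matrix (Fin k) (Fin n) R) {S : Finset (Fin n)} (hS : S.card + 2 = k)
    {a b c d : Fin n} (hab : a < b) (hbc : b < c) (hcd : c < d)
    (ha : a ∉ S) (hb : b ∉ S) (hc : c ∉ S) (hd : d ∉ S) :
    pMinor A (S ∪ {a, c}) * pMinor A (S ∪ {b, d}) =
      pMinor A (S ∪ {a, b}) * pMinor A (S ∪ {c, d}) +
        pMinor A (S ∪ {a, d}) * pMinor A (S ∪ {b, c}) := by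
  subst hS
  have key := det_vecCons_three_term (fun i => A.transpose (S.orderEmbOfFin rfl i))
    (A.transpose a) (A.transpose b) (A.transpose c) (A.transpose d)
  rw [pMinor_union_pair A rfl hab ha hb, pMinor_union_pair A rfl hcd hc hd,
    pMinor_union_pair A rfl (hab.trans hbc) ha hc, pMinor_union_pair A rfl (hbc.trans hcd) hb hd,
    pMinor_union_pair A rfl (hab.trans (hbc.trans hcd)) ha hd, pMinor_union_pair A rfl hbc hb hc]
  set q : Fin n → R := fun u =>
    (Int.sign (∏ i, (((S.orderEmbOfFin rfl i : ℕ) : ℤ) - ((u : ℕ) : ℤ))) : R)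
  linear_combination (q a * q b * q c * q d) * key

/-- No cancellation of leading terms in a sum of two Hahn series with positive leading
coefficients. -/
theorem HahnSeries.order_add_of_leadingCoeff_pos {Γ R : Type*} [LinearOrder Γ] [Zero Γ]
    [AddCommGroup R] [PartialOrder R] [IsOrderedAddMonoid R] {y z : HahnSeries Γ R}
    (hy : 0 < y.leadingCoeff) (hz : 0 < z.leadingCoeff) (hyz : y.order ≤ z.order) :
    (y + z).order = y.order := by
  have hzc : 0 ≤ z.coeff y.order := by
    rcases hyz.lt_or_eq with h | h
    · exact (HahnSeries.coeff_eq_zero_of_lt_order h).ge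
    · rw [h, ← HahnSeries.leadingCoeff_eq]; exact hz.le
  have hne : (y + z).coeff y.order ≠ 0 := by
    rw [HahnSeries.coeff_add, ← HahnSeries.leadingCoeff_eq]
    exact (add_pos_of_pos_of_nonneg hy hzc).ne'
  refine le_antisymm (HahnSeries.order_le_of_coeff_ne_zero hne) ?_
  have hne' : y + z ≠ 0 := by
    intro h
    simp [h] at hne
  simpa [min_eq_left hyz] using HahnSeries.min_order_le_order_add hne'

/-- If all maximal minors of a `k × n` matrix over the Hahn series field are nonzero
with positive leading coefficient, then the valuations of the maximal minors form a
positive tropical Plücker vector. -/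
theorem stmt_17 (k n : ℕ) (hk : 0 < k) (hkn : k < n)
    (A : Matrix (Fin k) (Fin n) (HahnSeries ℝ ℝ))
    (hA : ∀ I : Finset (Fin n), I.card = k → pMinor A I ≠ 0 ∧ 0 < lc (pMinor A I))
    (P : Finset (Fin n) → ℝ) (hP : ∀ I : Finset (Fin n), I.card = k → P I = ord (pMinor A I)) :
    ∀ S : Finset (Fin n), S.card + 2 = k →
      ∀ a b c d : Fin n, a < b → b < c → c < d →
        a ∉ S → b ∉ S → c ∉ S → d ∉ S →
        ((P (S ∪ {a, c}) + P (S ∪ {b, d}) = P (S ∪ {a, b}) + P (S ∪ {c, d}) ∧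
          P (S ∪ {a, b}) + P (S ∪ {c, d}) ≤ P (S ∪ {a, d}) + P (S ∪ {b, c})) ∨
         (P (S ∪ {a, c}) + P (S ∪ {b, d}) = P (S ∪ {a, d}) + P (S ∪ {b, c}) ∧
          P (S ∪ {a, d}) + P (S ∪ {b, c}) ≤ P (S ∪ {a, b}) + P (S ∪ {c, d}))) := by
  intro S hS a b c d hab hbc hcd ha hb hc hd
  have hcard {u v : Fin n} (huv : u < v) (hu : u ∉ S) (hv : v ∉ S) :
      (S ∪ {u, v}).card = k := by
    rw [Finset.card_union_of_disjoint (by simp [hu, hv]), Finset.card_pair huv.ne, hS]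
  have hsum {I J : Finset (Fin n)} (hI : I.card = k) (hJ : J.card = k) :
      P I + P J = (pMinor A I * pMinor A J).order := by
    rw [hP I hI, hP J hJ, HahnSeries.order_mul (hA I hI).1 (hA J hJ).1]
    rfl
  have hpos {I J : Finset (Fin n)} (hI : I.card = k) (hJ : J.card = k) :
      0 < (pMinor A I * pMinor A J).leadingCoeff := by
    rw [HahnSeries.leadingCoeff_mul]
    exact mul_pos (hA I hI).2 (hA J hJ).2
  have hIab := hcard hab ha hb
  have hIcd := hcard hcd hc hd
  have hIad := hcard (hab.trans (hbc.trans hcd)) ha hd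
  have hIbc := hcard hbc hb hc
  rw [hsum (hcard (hab.trans hbc) ha hc) (hcard (hbc.trans hcd) hb hd), hsum hIab hIcd,
    hsum hIad hIbc, pMinor_three_term A hS hab hbc hcd ha hb hc hd]
  rcases le_total (pMinor A (S ∪ {a, b}) * pMinor A (S ∪ {c, d})).order
    (pMinor A (S ∪ {a, d}) * pMinor A (S ∪ {b, c})).order with h | h
  · exact Or.inl ⟨HahnSeries.order_add_of_leadingCoeff_pos (hpos hIab hIcd) (hpos hIad hIbc) h, h⟩
  · refine Or.inr ⟨?_, h⟩
    rw [add_comm]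
    exact HahnSeries.order_add_of_leadingCoeff_pos (hpos hIad hIbc) (hpos hIab hIcd) h
end
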